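/- For positive integers b > a, writing b = q(a+1) + r with 0 ≤ r ≤ a, we have 1 + (3/2)b + (1/2)·((a+1−r)q² + r(q+1)²) = (a+1)(q+1)(q+2)/2 − a + r(q+2). Consequently, the minimum area of a polygon realizing a two-opposite-stair xy-monotone angle sequence with stair lengths a and b (b > a) equals (a+1)(q+1)(q+2)/2 − a + r(q+2). -/

import Mathlib

/-- Cross product of two planar integer vectors. -/
def cross (d e : ℤ × ℤ) : ℤ := d.1 * e.2 - d.2 * e.1

/-- Membership in an axis-parallel lattice segment with endpoints `a`, `b`. -/
def onSeg (a b p : ℤ × ℤ) : Prop :=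
  min a.1 b.1 ≤ p.1 ∧ p.1 ≤ max a.1 b.1 ∧ min a.2 b.2 ≤ p.2 ∧ p.2 ≤ max a.2 b.2

/-- A simple rectilinear lattice polygon with `n` vertices: all edges are
axis-parallel, consecutive edges are perpendicular, and non-adjacent edges are
disjoint (adjacent edges meet only in their common endpoint). -/
structure RectPolygon (n : ℕ) where
  v : ZMod n → ℤ × ℤ
  nondeg : ∀ i, v (i + 1) ≠ v i
  axis : ∀ i, (v (i + 1)).1 = (v i).1 ∨ (v (i + 1)).2 = (v i).2
  alt : ∀ i, ((v (i + 1)).1 = (v i).1 ↔ (v (i + 2)).2 = (v (i + 1)).2)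
  simple : ∀ i j : ZMod n, j ≠ i → ∀ p : ℤ × ℤ,
    onSeg (v i) (v (i + 1)) p → onSeg (v j) (v (j + 1)) p →
    (j = i + 1 ∧ p = v j) ∨ (i = j + 1 ∧ p = v i)

namespace RectPolygon

variable {n : ℕ}

/-- Vector of edge `i` (from vertex `i` to vertex `i+1`). -/
def dvec (P : RectPolygon n) (i : ZMod n) : ℤ × ℤ := P.v (i + 1) - P.v i

/-- The turn at vertex `i` is a left (+90°, convex) turn. -/
def convexAt (P : RectPolygon n) (i : ZMod n) : Prop := 0 < cross (P.dvec (i - 1)) (P.dvec i)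

/-- The turn at vertex `i` is a right (−90°, reflex) turn. -/
def reflexAt (P : RectPolygon n) (i : ZMod n) : Prop := cross (P.dvec (i - 1)) (P.dvec i) < 0

def horiz (P : RectPolygon n) (i : ZMod n) : Prop := (P.v (i + 1)).2 = (P.v i).2

def vert (P : RectPolygon n) (i : ZMod n) : Prop := (P.v (i + 1)).1 = (P.v i).1

/-- Signed x-extent of edge `i`. -/
def sx (P : RectPolygon n) (i : ZMod n) : ℤ := (P.v (i + 1)).1 - (P.v i).1

/-- Signed y-extent of edge `i`. -/
def sy (P : RectPolygon n) (i : ZMod n) : ℤ := (P.v (i + 1)).2 - (P.v i).2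

/-- Length of edge `i`. -/
def elen (P : RectPolygon n) (i : ZMod n) : ℤ :=
  |(P.v (i + 1)).1 - (P.v i).1| + |(P.v (i + 1)).2 - (P.v i).2|

section
variable [NeZero n]

/-- Counterclockwise orientation (positive shoelace signed area). -/
def ccw (P : RectPolygon n) : Prop := 0 < ∑ i : ZMod n, cross (P.v i) (P.v (i + 1))

/-- The enclosed area of a ccw polygon (shoelace formula); for a rectilinear
lattice polygon this is the number of interior unit grid cells. -/
def area (P : RectPolygon n) : ℤ := (∑ i : ZMod n, cross (P.v i) (P.v (i + 1))) / 2

/-- Perimeter: total length of all edges. -/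
def perimeter (P : RectPolygon n) : ℤ := ∑ i : ZMod n, P.elen i

def maxX (P : RectPolygon n) : ℤ := Finset.univ.sup' Finset.univ_nonempty fun i : ZMod n => (P.v i).1
def minX (P : RectPolygon n) : ℤ := Finset.univ.inf' Finset.univ_nonempty fun i : ZMod n => (P.v i).1
def maxY (P : RectPolygon n) : ℤ := Finset.univ.sup' Finset.univ_nonempty fun i : ZMod n => (P.v i).2
def minY (P : RectPolygon n) : ℤ := Finset.univ.inf' Finset.univ_nonempty fun i : ZMod n => (P.v i).2

/-- Width of the bounding box (a single unit edge gives width 1). -/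
def width (P : RectPolygon n) : ℤ := P.maxX - P.minX

/-- Height of the bounding box. -/
def height (P : RectPolygon n) : ℤ := P.maxY - P.minY

/-- Area of the bounding box. -/
def bboxArea (P : RectPolygon n) : ℤ := P.width * P.height

end

/-- A simple rectilinear polygon is x-monotone iff the cyclic sequence of
x-directions of its horizontal edges has exactly two reversals. -/
def IsXMonotone (P : RectPolygon n) : Prop :=
  {i : ZMod n | P.horiz i ∧ P.sx i * P.sx (i + 2) < 0}.ncard = 2

def IsYMonotone (P : RectPolygon n) : Prop :=
  {i : ZMod n | P.vert i ∧ P.sy i * P.sy (i + 2) < 0}.ncard = 2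

def IsXYMonotone (P : RectPolygon n) : Prop := P.IsXMonotone ∧ P.IsYMonotone

/-- In a ccw x-monotone polygon, a reflex vertex lies on the upper chain iff its
adjacent horizontal edge points leftwards. -/
def upperReflex (P : RectPolygon n) (i : ZMod n) : Prop :=
  P.reflexAt i ∧ ((P.horiz (i - 1) ∧ P.sx (i - 1) < 0) ∨ (P.horiz i ∧ P.sx i < 0))

def lowerReflex (P : RectPolygon n) (i : ZMod n) : Prop :=
  P.reflexAt i ∧ ((P.horiz (i - 1) ∧ 0 < P.sx (i - 1)) ∨ (P.horiz i ∧ 0 < P.sx i))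

/-- Number of reflex vertices on the upper chain T. -/
noncomputable def rT (P : RectPolygon n) : ℕ := {i : ZMod n | P.upperReflex i}.ncard

/-- Number of reflex vertices on the lower chain B. -/
noncomputable def rB (P : RectPolygon n) : ℕ := {i : ZMod n | P.lowerReflex i}.ncard

end RectPolygon

/-- The block (LR)^k of an angle sequence (`true` = L, `false` = R). -/
def LRblock (k : ℕ) : List Bool := (List.replicate k [true, false]).flatten

/-- `P` realizes the angle sequence `S` via a counterclockwise boundary walk. -/
def realizes {m : ℕ} [NeZero m] (S : List Bool) (P : RectPolygon m) : Prop :=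
  m = S.length ∧ P.ccw ∧ ∀ i : Fin S.length,
    ((S.get i = true) ↔ P.convexAt ((i : ℕ) : ZMod m)) ∧
    ((S.get i = false) ↔ P.reflexAt ((i : ℕ) : ZMod m))

instance (k : ℕ) : NeZero (k + 4) := ⟨by omega⟩

/-- The angle sequence of an xy-monotone polygon with two nonempty opposite
stairs BL (with `b` reflex vertices) and TR (with `a` reflex vertices):
cyclically L (LR)^b L L (LR)^a L, i.e. four extreme edges and two stairs. -/
def twoStairSeq (a b : ℕ) : List Bool :=
  [true] ++ LRblock b ++ [true, true] ++ LRblock a ++ [true]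


/-- Area bound over one step of the upper stair. -/
theorem strip_bound {x y : ℕ → ℤ} {s m : ℕ} {X X' : ℤ} (hsm : s ≤ m)
    (hx : ∀ i < m, x i < x (i + 1)) (hy : ∀ i < m, y i < y (i + 1))
    (hX : s < m → X < x (s + 1)) :
    2 * (y m - y s) + ((m : ℤ) - s) * ((m : ℤ) - s - 1) ≤
      2 * (y m * (X' - X) -
        ((∑ i ∈ Finset.range m, (x (i + 1) - x i) * y i) + (X' - x m) * y m -
          (∑ i ∈ Finset.range s, (x (i + 1) - x i) * y i) - (X - x s) * y s)) := by
  have hgap : ∀ t ≤ m, (m : ℤ) - t ≤ y m - y t := by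
    intro t ht
    induction ht using Nat.decreasingInduction with
    | self => simp
    | of_succ k hk ih =>
      have := hy k hk
      push_cast at ih
      linarith
  rcases hsm.eq_or_lt with rfl | hlt
  · have h : (s : ℤ) - s = 0 := by ring
    rw [h]
    linarith
  · have key : ∀ t, s + 1 ≤ t → t ≤ m →
        2 * (y m - y s) + ((m : ℤ) - s) * ((m : ℤ) - s - 1) - ((m : ℤ) - t) * ((m : ℤ) - t + 1) ≤
          2 * (y m * (x t - X) - ((∑ i ∈ Finset.range t, (x (i + 1) - x i) * y i) -
            (∑ i ∈ Finset.range s, (x (i + 1) - x i) * y i) - (X - x s) * y s)) := by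
      intro t ht
      induction t, ht using Nat.le_induction with
      | base =>
        intro _
        have h1 := hX hlt
        have h2 := hgap s hsm
        have h3 : (s : ℤ) < m := by exact_mod_cast hlt
        rw [Finset.sum_range_succ]
        push_cast
        nlinarith [mul_nonneg (show (0 : ℤ) ≤ x (s + 1) - X - 1 by linarith)
          (show (0 : ℤ) ≤ y m - y s by linarith)]
      | succ t ht ih =>
        intro htm
        have h1 := hx t (by omega)
        have h2 := hgap t (by omega)
        have h3 : (t : ℤ) < m := by exact_mod_cast htm
        have h4 := ih (by omega)
        rw [Finset.sum_range_succ]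
        push_cast
        nlinarith [mul_nonneg (show (0 : ℤ) ≤ x (t + 1) - x t - 1 by linarith)
          (show (0 : ℤ) ≤ y m - y t by linarith)]
    have := key m hlt le_rfl
    have h : (m : ℤ) - m = 0 := by ring
    rw [h] at this
    linarith

/-- A lower stair not meeting the horizontal edges of the upper stair stays below it. -/
theorem lower_lt_upper {a b : ℕ} {x y X Y : ℕ → ℤ}
    (hx : ∀ i ≤ b, x i < x (i + 1)) (hY : ∀ j ≤ a, Y j < Y (j + 1))
    (h0 : x 0 = X 0) (h0' : y 0 = Y 0)
    (hsep : ∀ i < b, ∀ j ≤ a, y i ≤ Y (j + 1) → Y (j + 1) ≤ y (i + 1) →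
      X j ≤ x (i + 1) → x (i + 1) ≤ X (j + 1) → False) :
    ∀ i ≤ b, ∀ j ≤ a, x i ≤ X (j + 1) → y i < Y (j + 1) := by
  intro i
  induction i with
  | zero =>
    intro _ j
    induction j with
    | zero => intro hj _; rw [h0']; exact hY 0 hj
    | succ j ih =>
      intro hj _
      have : ∀ k ≤ a, Y 0 < Y (k + 1) := by
        intro k
        induction k with
        | zero => exact fun hk => hY 0 hk
        | succ k ihk => exact fun hk => (ihk (by omega)).trans (hY _ hk)
      rw [h0']
      exact this _ hj
  | succ i ih =>
    intro hi j
    have hxi := hx i (by omega)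
    induction j with
    | zero =>
      intro hj hle
      by_contra! hcon
      have hlt := ih (by omega) 0 hj (by linarith)
      have hmono : ∀ k ≤ b + 1, x 0 ≤ x k := by
        intro k
        induction k with
        | zero => simp
        | succ k ihk => exact fun hk => (ihk (by omega)).trans (hx k (by omega)).le
      exact hsep i (by omega) 0 hj hlt.le hcon (h0 ▸ hmono _ (by omega)) hle
    | succ j ihj =>
      intro hj hle
      by_contra! hcon
      have hlt := ih (by omega) (j + 1) hj (by linarith)
      rcases le_total (X (j + 1)) (x (i + 1)) with h | h
      · exact hsep i (by omega) (j + 1) hj hlt.le hcon h hle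
      · have := ihj (by omega) h
        have := hY (j + 1) hj
        linarith

theorem stairs_area_bound {a b : ℕ} (q : ℤ) {x y X Y : ℕ → ℤ}
    (hx : ∀ i ≤ b, x i < x (i + 1)) (hy : ∀ i ≤ b, y i < y (i + 1))
    (hX : ∀ j ≤ a, X j < X (j + 1)) (hY : ∀ j ≤ a, Y j < Y (j + 1))
    (h0 : x 0 = X 0) (h0' : y 0 = Y 0) (hend : x (b + 1) = X (a + 1))
    (hsep : ∀ i < b, ∀ j ≤ a, y i ≤ Y (j + 1) → Y (j + 1) ≤ y (i + 1) →
      X j ≤ x (i + 1) → x (i + 1) ≤ X (j + 1) → False) :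
    2 * (2 * (b : ℤ) + 1) + 2 * q * b - ((a : ℤ) + 1) * (q * (q + 1)) ≤
      2 * ((∑ j ∈ Finset.range (a + 1), (X (j + 1) - X j) * Y (j + 1)) -
        ∑ i ∈ Finset.range (b + 1), (x (i + 1) - x i) * y i) := by
  have hlow := lower_lt_upper hx hY h0 h0' hsep
  have hX0 : ∀ j ≤ a + 1, X 0 ≤ X j := by
    intro j
    induction j with
    | zero => simp
    | succ j ih => exact fun hj => (ih (by omega)).trans (hX j (by omega)).le
  let s : ℕ → ℕ := fun j => Nat.findGreatest (fun i => x i ≤ X j) b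
  have hsb : ∀ j, s j ≤ b := fun j => Nat.findGreatest_le b
  have hs1 : ∀ j ≤ a + 1, x (s j) ≤ X j := fun j hj =>
    Nat.findGreatest_spec (P := fun i => x i ≤ X j) (Nat.zero_le b) (h0.le.trans (hX0 j hj))
  have hs2 : ∀ j i, s j < i → i ≤ b → X j < x i := fun j i h1 h2 =>
    not_le.1 (Nat.findGreatest_is_greatest (P := fun i => x i ≤ X j) h1 h2)
  have hs0 : s 0 = 0 := by
    have hmono : ∀ k ≤ b, 0 < k → x 0 < x k := by
      intro k
      induction k with
      | zero => simp
      | succ k ihk =>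
        intro hk _
        rcases Nat.eq_zero_or_pos k with rfl | hpos
        · exact hx 0 (by omega)
        · exact (ihk (by omega) hpos).trans (hx k (by omega))
    by_contra hne
    have h1 := hs1 0 (by omega)
    have h2 := hmono _ (hsb 0) (Nat.pos_of_ne_zero hne)
    linarith
  have hsend : s (a + 1) = b := by
    by_contra hne
    have h1 := hs2 (a + 1) b (lt_of_le_of_ne (hsb _) hne) le_rfl
    have h2 := hx b le_rfl
    linarith
  have key : ∀ j ≤ a + 1, 2 * (y (s j) - y 0) + 2 * (X j - X 0) + 2 * q * s j -
      j * (q * (q + 1)) ≤ 2 * ((∑ j ∈ Finset.range j, (X (j + 1) - X j) * Y (j + 1)) -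
        ((∑ i ∈ Finset.range (s j), (x (i + 1) - x i) * y i) + (X j - x (s j)) * y (s j))) := by
    intro j
    induction j with
    | zero => intro _; simp [hs0, h0]
    | succ j ih =>
      intro hj
      have ih' := ih (by omega)
      have hXj := hX j (by omega)
      have hmono : s j ≤ s (j + 1) := by
        by_contra! h
        have h1 := hs2 (j + 1) (s j) h (hsb _)
        have h2 := hs1 j (by omega)
        linarith
      have hstrip := strip_bound (x := x) (y := y) (X := X j) (X' := X (j + 1)) hmono
        (fun i hi => hx i (by have := hsb (j + 1); omega))
        (fun i hi => hy i (by have := hsb (j + 1); omega))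
        (fun h => hs2 j _ (by omega) (by have := hsb (j + 1); omega))
      have hYj := hlow (s (j + 1)) (hsb _) j (by omega) (hs1 _ hj)
      have htan : 0 ≤ ((s (j + 1) : ℤ) - s j - q) * ((s (j + 1) : ℤ) - s j - q - 1) := by
        rcases le_or_gt ((s (j + 1) : ℤ) - s j - q) 0 with h | h
        · exact mul_nonneg_of_nonpos_of_nonpos h (by linarith)
        · exact mul_nonneg h.le (by linarith)
      have hprod := mul_nonneg (show (0 : ℤ) ≤ X (j + 1) - X j by linarith)
        (show (0 : ℤ) ≤ Y (j + 1) - (y (s (j + 1)) + 1) by linarith)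
      rw [Finset.sum_range_succ]
      push_cast
      nlinarith
  have hfin := key (a + 1) le_rfl
  rw [hsend] at hfin
  have hW : ∀ k ≤ b + 1, (k : ℤ) ≤ x k - x 0 := by
    intro k
    induction k with
    | zero => simp
    | succ k ih =>
      intro hk
      have h1 := ih (by omega)
      have h2 := hx k (by omega)
      push_cast
      linarith
  have hH : ∀ k ≤ b, (k : ℤ) ≤ y k - y 0 := by
    intro k
    induction k with
    | zero => simp
    | succ k ih =>
      intro hk
      have h1 := ih (by omega)
      have h2 := hy k (by omega)
      push_cast
      linarith
  have h1 := hW (b + 1) le_rfl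
  have h2 := hH b le_rfl
  rw [Finset.sum_range_succ (fun i => (x (i + 1) - x i) * y i) b, hend]
  push_cast at hfin h1 ⊢
  linarith

namespace RectPolygon

variable {n : ℕ}

/-- The polygon turned by a quarter turn about the origin. -/
def rotate (P : RectPolygon n) : RectPolygon n where
  v i := (-(P.v i).2, (P.v i).1)
  nondeg i h := P.nondeg i (by
    simp only [Prod.mk.injEq, neg_inj] at h
    exact Prod.ext h.2 h.1)
  axis i := by simpa using (P.axis i).symm
  alt i := by
    have h0 := P.nondeg i
    have h1 := P.nondeg (i + 1)
    have h2 := P.axis i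
    have h3 := P.axis (i + 1)
    have h4 := P.alt i
    rw [add_assoc, one_add_one_eq_two] at h1 h3
    rw [Ne, Prod.ext_iff] at h0 h1
    simp only [neg_inj]
    tauto
  simple i j hij p hi hj := by
    have h := P.simple i j hij (p.2, -p.1)
    simp only [onSeg] at hi hj h
    have h' := h (by omega) (by omega)
    simp only [Prod.ext_iff] at h' ⊢
    refine h'.imp (fun h => ⟨h.1, ?_, ?_⟩) (fun h => ⟨h.1, ?_, ?_⟩) <;> omega

theorem cross_rotate (d e : ℤ × ℤ) : cross (-d.2, d.1) (-e.2, e.1) = cross d e := by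
  simp only [cross]; ring

theorem dvec_rotate (P : RectPolygon n) (i : ZMod n) :
    P.rotate.dvec i = (-(P.dvec i).2, (P.dvec i).1) := by
  simp only [dvec, rotate, Prod.ext_iff, Prod.fst_sub, Prod.snd_sub, and_true]
  ring

/-- The edge leaving vertex `i` points in the direction of the positive first axis. -/
def Rightward (P : RectPolygon n) (i : ZMod n) : Prop := 0 < (P.dvec i).1 ∧ (P.dvec i).2 = 0

/-- The edge leaving vertex `i` points in the direction of the positive second axis. -/
def Upward (P : RectPolygon n) (i : ZMod n) : Prop := (P.dvec i).1 = 0 ∧ 0 < (P.dvec i).2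

/-- The edge leaving vertex `i` points in the direction of the negative first axis. -/
def Leftward (P : RectPolygon n) (i : ZMod n) : Prop := (P.dvec i).1 < 0 ∧ (P.dvec i).2 = 0

/-- The edge leaving vertex `i` points in the direction of the negative second axis. -/
def Downward (P : RectPolygon n) (i : ZMod n) : Prop := (P.dvec i).1 = 0 ∧ (P.dvec i).2 < 0

theorem dvec_axis (P : RectPolygon n) (i : ZMod n) : (P.dvec i).1 = 0 ∨ (P.dvec i).2 = 0 := by
  simp only [dvec, Prod.fst_sub, Prod.snd_sub, sub_eq_zero]
  exact P.axis i

theorem dvec_ne (P : RectPolygon n) (i : ZMod n) : (P.dvec i).1 ≠ 0 ∨ (P.dvec i).2 ≠ 0 := by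
  have h := P.nondeg i
  rw [Ne, Prod.ext_iff] at h
  simp only [dvec, Prod.fst_sub, Prod.snd_sub, ne_eq, sub_eq_zero]
  tauto

theorem Rightward.upward {P : RectPolygon n} {i : ZMod n} (h : P.Rightward i)
    (hc : P.convexAt (i + 1)) : P.Upward (i + 1) := by
  obtain ⟨h1, h2⟩ := h
  simp only [convexAt, cross, add_sub_cancel_right, h2, zero_mul, sub_zero] at hc
  have h3 := (pos_iff_pos_of_mul_pos hc).1 h1
  exact ⟨(P.dvec_axis (i + 1)).resolve_right h3.ne', h3⟩

theorem Upward.rightward {P : RectPolygon n} {i : ZMod n} (h : P.Upward i)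
    (hc : P.reflexAt (i + 1)) : P.Rightward (i + 1) := by
  obtain ⟨h1, h2⟩ := h
  simp only [reflexAt, cross, add_sub_cancel_right, h1, zero_mul, zero_sub, neg_neg_iff_pos] at hc
  have h3 := (pos_iff_pos_of_mul_pos hc).1 h2
  exact ⟨h3, (P.dvec_axis (i + 1)).resolve_left h3.ne'⟩

theorem Upward.leftward {P : RectPolygon n} {i : ZMod n} (h : P.Upward i)
    (hc : P.convexAt (i + 1)) : P.Leftward (i + 1) := by
  obtain ⟨h1, h2⟩ := h
  simp only [convexAt, cross, add_sub_cancel_right, h1, zero_mul, zero_sub, neg_pos] at hc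
  have h3 := neg_of_mul_neg_right hc h2.le
  exact ⟨h3, (P.dvec_axis (i + 1)).resolve_left h3.ne⟩

theorem Leftward.downward {P : RectPolygon n} {i : ZMod n} (h : P.Leftward i)
    (hc : P.convexAt (i + 1)) : P.Downward (i + 1) := by
  obtain ⟨h1, h2⟩ := h
  simp only [convexAt, cross, add_sub_cancel_right, h2, zero_mul, sub_zero] at hc
  have h3 := (neg_iff_neg_of_mul_pos hc).1 h1
  exact ⟨(P.dvec_axis (i + 1)).resolve_right h3.ne, h3⟩

theorem Downward.leftward {P : RectPolygon n} {i : ZMod n} (h : P.Downward i)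
    (hc : P.reflexAt (i + 1)) : P.Leftward (i + 1) := by
  obtain ⟨h1, h2⟩ := h
  simp only [reflexAt, cross, add_sub_cancel_right, h1, zero_mul, zero_sub, neg_neg_iff_pos] at hc
  have h3 := (neg_iff_neg_of_mul_pos hc).1 h2
  exact ⟨h3, (P.dvec_axis (i + 1)).resolve_left h3.ne⟩

theorem realizes_rotate [NeZero n] {S : List Bool} {P : RectPolygon n} (h : realizes S P) :
    realizes S P.rotate := by
  obtain ⟨h1, h2, h3⟩ := h
  refine ⟨h1, ?_, ?_⟩
  · simpa only [ccw, rotate, cross_rotate] using h2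
  · simpa only [convexAt, reflexAt, dvec_rotate, cross_rotate] using h3

theorem area_rotate [NeZero n] (P : RectPolygon n) : P.rotate.area = P.area := by
  simp only [area, rotate, cross_rotate]

/-- After a suitable number of quarter turns the first edge points rightward. -/
theorem exists_rightward [NeZero n] {S : List Bool} {P : RectPolygon n} (h : realizes S P) :
    ∃ Q : RectPolygon n, realizes S Q ∧ Q.area = P.area ∧ Q.Rightward 0 := by
  by_cases h0 : P.Rightward 0
  · exact ⟨P, h, rfl, h0⟩
  by_cases h1 : P.rotate.Rightward 0
  · exact ⟨_, realizes_rotate h, P.area_rotate, h1⟩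
  by_cases h2 : P.rotate.rotate.Rightward 0
  · exact ⟨_, realizes_rotate (realizes_rotate h), by simp only [area_rotate], h2⟩
  · refine ⟨P.rotate.rotate.rotate, realizes_rotate (realizes_rotate (realizes_rotate h)),
      by simp only [area_rotate], ?_⟩
    have h3 := P.dvec_axis 0
    have h4 := P.dvec_ne 0
    simp only [Rightward, dvec_rotate] at *
    omega

theorem sum_eq_sum_range [NeZero n] {M : Type*} [AddCommMonoid M] (f : ZMod n → M) :
    ∑ i : ZMod n, f i = ∑ k ∈ Finset.range n, f (k : ZMod n) := by
  refine Finset.sum_nbij' (fun i => i.val) (fun k => (k : ZMod n)) ?_ ?_ ?_ ?_ ?_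
  · simp [ZMod.val_lt]
  · simp
  · simp
  · intro k hk
    exact ZMod.val_cast_of_lt (Finset.mem_range.1 hk)
  · simp

end RectPolygon

theorem sum_range_two_mul {M : Type*} [AddCommMonoid M] (f : ℕ → M) (N : ℕ) :
    ∑ k ∈ Finset.range (2 * N), f k = ∑ i ∈ Finset.range N, (f (2 * i) + f (2 * i + 1)) := by
  induction N with
  | zero => simp
  | succ N ih => rw [mul_add, mul_one, Finset.sum_range_succ, Finset.sum_range_succ, ih,
      Finset.sum_range_succ, add_assoc]

theorem LRblock_getElem? (k m : ℕ) (hm : m < 2 * k) :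
    (LRblock k)[m]? = some (decide (m % 2 = 0)) := by
  induction k generalizing m with
  | zero => omega
  | succ k ih =>
    have h : LRblock (k + 1) = true :: false :: LRblock k := by
      simp [LRblock, List.replicate_succ]
    rw [h]
    rcases m with _ | _ | m
    · rfl
    · rfl
    · simp only [List.getElem?_cons_succ, ih m (by omega), Nat.add_assoc, Nat.reduceAdd,
        Nat.add_mod_right]

theorem LRblock_length (k : ℕ) : (LRblock k).length = 2 * k := by
  simp [LRblock, mul_comm]

theorem twoStairSeq_length (a b : ℕ) : (twoStairSeq a b).length = 2 * (a + b) + 4 := by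
  simp [twoStairSeq, LRblock_length]
  ring

/-- The left turns of the two-stair sequence are at the odd positions and at the two corners. -/
theorem twoStairSeq_getElem? (a b m : ℕ) (hm : m < 2 * (a + b) + 4) :
    (twoStairSeq a b)[m]? = some (decide (m % 2 = 1 ∨ m = 0 ∨ m = 2 * b + 2)) := by
  simp only [twoStairSeq, List.getElem?_append, List.length_append, LRblock_length,
    List.length_cons, List.length_nil]
  split_ifs with h1 h2 h3 h4
  · obtain rfl : m = 0 := by omega
    simp
  · rw [LRblock_getElem? _ _ (by omega)]
    simp only [Option.some.injEq, decide_eq_decide]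
    omega
  · obtain rfl | rfl : m = 2 * b + 1 ∨ m = 2 * b + 2 := by omega
    · simp [show 2 * b + 1 - (0 + 1 + 2 * b) = 0 by omega, Nat.add_mod]
    · simp [show 2 * b + 2 - (0 + 1 + 2 * b) = 1 by omega]
  · rw [LRblock_getElem? _ _ (by omega)]
    simp only [Option.some.injEq, decide_eq_decide]
    omega
  · obtain rfl : m = 2 * (a + b) + 3 := by omega
    simp [show 2 * (a + b) + 3 - (0 + 1 + 2 * b + (0 + 1 + 1) + 2 * a) = 0 by omega, Nat.add_mod]

theorem realizes_twoStairSeq_iff {a b n : ℕ} [NeZero n] (hn : n = 2 * (a + b) + 4)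
    (P : RectPolygon n) : realizes (twoStairSeq a b) P ↔ P.ccw ∧
      ∀ m < n, (m % 2 = 1 ∨ m = 0 ∨ m = 2 * b + 2 → P.convexAt m) ∧
        (m % 2 = 0 → m ≠ 0 → m ≠ 2 * b + 2 → P.reflexAt m) := by
  have hget : ∀ (m : ℕ) (hm : m < (twoStairSeq a b).length), (twoStairSeq a b).get ⟨m, hm⟩ =
      decide (m % 2 = 1 ∨ m = 0 ∨ m = 2 * b + 2) := by
    intro m hm
    have h := twoStairSeq_getElem? a b m (by rwa [twoStairSeq_length] at hm)
    rw [List.getElem?_eq_getElem hm] at h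
    exact Option.some_injective _ h
  constructor
  · rintro ⟨-, h2, h3⟩
    refine ⟨h2, fun m hm => ?_⟩
    have hm' : m < (twoStairSeq a b).length := by rw [twoStairSeq_length]; omega
    obtain ⟨h4, h5⟩ := h3 ⟨m, hm'⟩
    rw [hget m hm'] at h4 h5
    simp only [decide_eq_true_eq, decide_eq_false_iff_not] at h4 h5
    exact ⟨fun h => h4.1 h, fun _ _ _ => h5.1 (by omega)⟩
  · rintro ⟨h2, h3⟩
    refine ⟨by rw [twoStairSeq_length, hn], h2, ?_⟩
    rintro ⟨m, hm⟩
    obtain ⟨h4, h5⟩ := h3 m (by rw [twoStairSeq_length] at hm; omega)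
    have hnot : ¬ (P.convexAt m ∧ P.reflexAt m) := fun h => lt_asymm h.1 h.2
    rw [hget m hm]
    simp only [decide_eq_true_eq, decide_eq_false_iff_not]
    by_cases h : m % 2 = 1 ∨ m = 0 ∨ m = 2 * b + 2
    · have := h4 h
      tauto
    · have := h5 (by omega) (by omega) (by omega)
      tauto

/-- The shoelace sum of a closed walk consisting of two staircases. -/
theorem sum_cross_stairs {a b n : ℕ} (hn : n = 2 * (a + b) + 4) {V : ℕ → ℤ × ℤ} (hV : V n = V 0)
    (hlow : ∀ i ≤ b, V (2 * i + 1) = ((V (2 * (i + 1))).1, (V (2 * i)).2))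
    (hup : ∀ j ≤ a, V (n - (2 * j + 1)) = ((V (n - 2 * j)).1, (V (n - 2 * (j + 1))).2)) :
    ∑ k ∈ Finset.range n, cross (V k) (V (k + 1)) =
      2 * ((∑ j ∈ Finset.range (a + 1),
          ((V (n - 2 * (j + 1))).1 - (V (n - 2 * j)).1) * (V (n - 2 * (j + 1))).2) -
        ∑ i ∈ Finset.range (b + 1), ((V (2 * (i + 1))).1 - (V (2 * i)).1) * (V (2 * i)).2) := by
  let W : ℕ → ℤ := fun k => (V k).1 * (V k).2
  have h1 : ∀ i ∈ Finset.range (b + 1),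
      cross (V (2 * i)) (V (2 * i + 1)) + cross (V (2 * i + 1)) (V (2 * i + 1 + 1)) =
        (W (2 * (i + 1)) - W (2 * i)) -
          2 * (((V (2 * (i + 1))).1 - (V (2 * i)).1) * (V (2 * i)).2) := by
    intro i hi
    rw [hlow i (Nat.lt_succ_iff.1 (Finset.mem_range.1 hi)), show 2 * i + 1 + 1 = 2 * (i + 1) by ring]
    simp only [cross, W]
    ring
  have h2 : ∀ j ∈ Finset.range (a + 1),
      cross (V (2 * (b + 1 + (a + 1 - 1 - j)))) (V (2 * (b + 1 + (a + 1 - 1 - j)) + 1)) +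
        cross (V (2 * (b + 1 + (a + 1 - 1 - j)) + 1))
          (V (2 * (b + 1 + (a + 1 - 1 - j)) + 1 + 1)) =
        2 * (((V (n - 2 * (j + 1))).1 - (V (n - 2 * j)).1) * (V (n - 2 * (j + 1))).2) -
          (W (n - 2 * (j + 1)) - W (n - 2 * j)) := by
    intro j hj
    have hj' : j ≤ a := Nat.lt_succ_iff.1 (Finset.mem_range.1 hj)
    rw [show 2 * (b + 1 + (a + 1 - 1 - j)) + 1 = n - (2 * j + 1) by omega,
      show 2 * (b + 1 + (a + 1 - 1 - j)) = n - 2 * (j + 1) by omega,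
      show n - (2 * j + 1) + 1 = n - 2 * j by omega, hup j hj']
    simp only [cross, W]
    ring
  conv_lhs => rw [show n = 2 * ((b + 1) + (a + 1)) by omega]
  rw [sum_range_two_mul, Finset.sum_range_add, ← Finset.sum_range_reflect _ (a + 1),
    Finset.sum_congr rfl h1, Finset.sum_congr rfl h2,
    Finset.sum_sub_distrib (fun i => W (2 * (i + 1)) - W (2 * i)),
    Finset.sum_sub_distrib _ (fun j => W (n - 2 * (j + 1)) - W (n - 2 * j)),
    Finset.sum_range_sub (fun i => W (2 * i)),
    Finset.sum_range_sub (fun j => W (n - 2 * j)), ← Finset.mul_sum, ← Finset.mul_sum]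
  have h3 : W (n - 2 * 0) = W (2 * 0) := by simp [W, hV]
  have h4 : n - 2 * (a + 1) = 2 * (b + 1) := by omega
  rw [h3, h4]
  ring

namespace RectPolygon

theorem exists_stairs_directions {a b n : ℕ} [NeZero n] (hn : n = 2 * (a + b) + 4)
    {P : RectPolygon n} (hP : realizes (twoStairSeq a b) P) (h0 : P.Rightward 0) :
    (∀ i ≤ b, P.Rightward (2 * i : ℕ) ∧ P.Upward (2 * i + 1 : ℕ)) ∧
      ∀ j ≤ a, P.Leftward (2 * b + 2 + 2 * j : ℕ) ∧ P.Downward (2 * b + 2 + 2 * j + 1 : ℕ) := by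
  obtain ⟨-, hturn⟩ := (realizes_twoStairSeq_iff hn P).1 hP
  have hc : ∀ m < n, m % 2 = 1 ∨ m = 0 ∨ m = 2 * b + 2 → P.convexAt m := fun m h => (hturn m h).1
  have hr : ∀ m < n, m % 2 = 0 → m ≠ 0 → m ≠ 2 * b + 2 → P.reflexAt m := fun m h => (hturn m h).2
  have hlow : ∀ i ≤ b, P.Rightward (2 * i : ℕ) ∧ P.Upward (2 * i + 1 : ℕ) := by
    have step : ∀ i ≤ b, P.Rightward (2 * i : ℕ) → P.Upward (2 * i + 1 : ℕ) := by
      intro i hi h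
      have := hc (2 * i + 1) (by omega) (by omega)
      rw [Nat.cast_succ] at this ⊢
      exact h.upward this
    intro i
    induction i with
    | zero =>
      have h : P.Rightward (2 * 0 : ℕ) := by simpa using h0
      exact fun hi => ⟨h, step 0 hi h⟩
    | succ i ih =>
      intro hi
      have h : P.Rightward (2 * (i + 1) : ℕ) := by
        have := hr (2 * i + 1 + 1) (by omega) (by omega) (by omega) (by omega)
        rw [show 2 * (i + 1) = 2 * i + 1 + 1 by ring]
        rw [Nat.cast_succ] at this ⊢
        exact (ih (by omega)).2.rightward this
      exact ⟨h, step _ hi h⟩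
  refine ⟨hlow, ?_⟩
  have step : ∀ j ≤ a, P.Leftward (2 * b + 2 + 2 * j : ℕ) →
      P.Downward (2 * b + 2 + 2 * j + 1 : ℕ) := by
    intro j hj h
    have := hc (2 * b + 2 + 2 * j + 1) (by omega) (by omega)
    rw [Nat.cast_succ] at this ⊢
    exact h.downward this
  intro j
  induction j with
  | zero =>
    have h : P.Leftward (2 * b + 2 + 2 * 0 : ℕ) := by
      have := hc (2 * b + 1 + 1) (by omega) (by omega)
      rw [show 2 * b + 2 + 2 * 0 = 2 * b + 1 + 1 by ring]
      rw [Nat.cast_succ] at this ⊢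
      exact (hlow b le_rfl).2.leftward this
    exact fun hj => ⟨h, step 0 hj h⟩
  | succ j ih =>
    intro hj
    have h : P.Leftward (2 * b + 2 + 2 * (j + 1) : ℕ) := by
      have := hr (2 * b + 2 + 2 * j + 1 + 1) (by omega) (by omega) (by omega) (by omega)
      rw [show 2 * b + 2 + 2 * (j + 1) = 2 * b + 2 + 2 * j + 1 + 1 by ring]
      rw [Nat.cast_succ] at this ⊢
      exact (ih (by omega)).2.leftward this
    exact ⟨h, step _ hj h⟩

theorem two_stair_area_ge {a b n : ℕ} [NeZero n] (hn : n = 2 * (a + b) + 4) (q : ℤ)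
    {P : RectPolygon n} (hP : realizes (twoStairSeq a b) P) :
    2 * (2 * (b : ℤ) + 1) + 2 * q * b - ((a : ℤ) + 1) * (q * (q + 1)) ≤ 2 * P.area := by
  obtain ⟨Q, hQ, hQP, hQ0⟩ := exists_rightward hP
  rw [← hQP]
  clear hQP hP P
  obtain ⟨hlow, hup⟩ := exists_stairs_directions hn hQ hQ0
  let V : ℕ → ℤ × ℤ := fun k => Q.v k
  have hV : V n = V 0 := by simp [V]
  have hlow' : ∀ i ≤ b, (V (2 * i)).1 < (V (2 * i + 1)).1 ∧ (V (2 * i + 1)).2 = (V (2 * i)).2 ∧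
      (V (2 * (i + 1))).1 = (V (2 * i + 1)).1 ∧ (V (2 * i + 1)).2 < (V (2 * (i + 1))).2 := by
    intro i hi
    obtain ⟨⟨h1, h2⟩, h3, h4⟩ := hlow i hi
    simp only [dvec, ← Nat.cast_succ, Prod.fst_sub, Prod.snd_sub, sub_pos, sub_eq_zero,
      Nat.succ_eq_add_one] at h1 h2 h3 h4
    exact ⟨h1, h2, h3, h4⟩
  have hup' : ∀ j ≤ a, (V (n - (2 * j + 1))).1 < (V (n - 2 * (j + 1))).1 ∧
      (V (n - (2 * j + 1))).2 = (V (n - 2 * (j + 1))).2 ∧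
      (V (n - 2 * j)).1 = (V (n - (2 * j + 1))).1 ∧
      (V (n - 2 * j)).2 < (V (n - (2 * j + 1))).2 := by
    intro j hj
    obtain ⟨⟨h1, h2⟩, h3, h4⟩ := hup (a - j) (by omega)
    simp only [dvec, ← Nat.cast_succ, Prod.fst_sub, Prod.snd_sub, sub_neg, sub_eq_zero,
      Nat.succ_eq_add_one] at h1 h2 h3 h4
    rw [show 2 * b + 2 + 2 * (a - j) + 1 + 1 = n - 2 * j by omega] at h3 h4
    rw [show 2 * b + 2 + 2 * (a - j) + 1 = n - (2 * j + 1) by omega] at h1 h2 h3 h4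
    rw [show 2 * b + 2 + 2 * (a - j) = n - 2 * (j + 1) by omega] at h1 h2
    exact ⟨h1, h2, h3, h4⟩
  have hsum := sum_cross_stairs hn hV
    (fun i hi => Prod.ext (hlow' i hi).2.2.1.symm (hlow' i hi).2.1)
    (fun j hj => Prod.ext (hup' j hj).2.2.1.symm (hup' j hj).2.1)
  have harea : Q.area = (∑ k ∈ Finset.range n, cross (V k) (V (k + 1))) / 2 := by
    simp only [area, sum_eq_sum_range, V, Nat.cast_succ]
  rw [harea, hsum, Int.mul_ediv_cancel_left _ two_ne_zero]
  refine stairs_area_bound q (x := fun i => (V (2 * i)).1) (y := fun i => (V (2 * i)).2)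
    (X := fun j => (V (n - 2 * j)).1) (Y := fun j => (V (n - 2 * j)).2)
    (fun i hi => ?_) (fun i hi => ?_) (fun j hj => ?_) (fun j hj => ?_) ?_ ?_ ?_ ?_
  · have := hlow' i hi
    linarith
  · have := hlow' i hi
    linarith
  · have := hup' j hj
    linarith
  · have := hup' j hj
    linarith
  · simp [hV]
  · simp [hV]
  · rw [show n - 2 * (a + 1) = 2 * (b + 1) by omega]
  · intro i hi j hj h1 h2 h3 h4
    have hl := hlow' i hi.le
    have hu := hup' j hj
    have hne : ∀ k l : ℕ, k < n → l < n → k ≠ l → (k : ZMod n) ≠ l := by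
      intro k l hk hl hkl h
      rw [ZMod.natCast_eq_natCast_iff', Nat.mod_eq_of_lt hk, Nat.mod_eq_of_lt hl] at h
      exact hkl h
    have hs := Q.simple (2 * i + 1 : ℕ) (n - 2 * (j + 1) : ℕ)
      (hne _ _ (by omega) (by omega) (by omega))
      ((V (2 * (i + 1))).1, (V (n - 2 * (j + 1))).2)
    rw [← Nat.cast_succ, ← Nat.cast_succ] at hs
    have hl' : onSeg (V (2 * i + 1)) (V (2 * (i + 1)))
        ((V (2 * (i + 1))).1, (V (n - 2 * (j + 1))).2) := by
      simp only [onSeg]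
      omega
    have hu' : onSeg (V (n - 2 * (j + 1))) (V (n - 2 * (j + 1) + 1))
        ((V (2 * (i + 1))).1, (V (n - 2 * (j + 1))).2) := by
      rw [show n - 2 * (j + 1) + 1 = n - (2 * j + 1) by omega]
      simp only [onSeg]
      omega
    rcases hs hl' hu' with ⟨h, -⟩ | ⟨h, -⟩
    · exact hne _ _ (by omega) (by omega) (by omega) h
    · exact hne _ _ (by omega) (by omega) (by omega) h

end RectPolygon

/-- The corners `(X j, Y j)` of a stair with `a + 1` steps from `(0, 0)` to `(b + 1, b + 1)` lying
above the diagonal. -/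
structure IsUpperStair (a b : ℕ) (X Y : ℕ → ℤ) : Prop where
  X_lt : ∀ j ≤ a, X j < X (j + 1)
  Y_lt : ∀ j ≤ a, Y j < Y (j + 1)
  X_zero : X 0 = 0
  Y_zero : Y 0 = 0
  X_last : X (a + 1) = b + 1
  Y_last : Y (a + 1) = b + 1
  above : ∀ j < a, X (j + 1) < Y (j + 1)

/-- The vertices of the polygon bounded below by the unit stair with `b + 1` steps and above by the
stair with corners `(X j, Y j)`. -/
def stairVertex (b n : ℕ) (X Y : ℕ → ℤ) (k : ℕ) : ℤ × ℤ :=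
  if k ≤ 2 * b + 2 then (((k + 1) / 2 : ℕ), (k / 2 : ℕ)) else (X ((n - k) / 2), Y ((n - k + 1) / 2))

namespace IsUpperStair

variable {a b n : ℕ} {X Y : ℕ → ℤ}

theorem vertex_even_low {i : ℕ} (hi : i ≤ b + 1) :
    stairVertex b n X Y (2 * i) = ((i : ℤ), (i : ℤ)) := by
  rw [stairVertex, if_pos (by omega), show (2 * i + 1) / 2 = i by omega, show 2 * i / 2 = i by omega]

theorem vertex_odd_low {i : ℕ} (hi : i ≤ b) :
    stairVertex b n X Y (2 * i + 1) = ((i : ℤ) + 1, (i : ℤ)) := by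
  rw [stairVertex, if_pos (by omega), show (2 * i + 1 + 1) / 2 = i + 1 by omega,
    show (2 * i + 1) / 2 = i by omega]
  push_cast
  rfl

theorem vertex_even_up (h : IsUpperStair a b X Y) (hn : n = 2 * (a + b) + 4) {j : ℕ}
    (hj : j ≤ a + 1) : stairVertex b n X Y (n - 2 * j) = (X j, Y j) := by
  rcases hj.eq_or_lt with rfl | hlt
  · rw [show n - 2 * (a + 1) = 2 * (b + 1) by omega, vertex_even_low le_rfl, h.X_last, h.Y_last]
    push_cast
    rfl
  · rw [stairVertex, if_neg (by omega), show (n - (n - 2 * j)) / 2 = j by omega,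
      show (n - (n - 2 * j) + 1) / 2 = j by omega]

theorem vertex_odd_up (hn : n = 2 * (a + b) + 4) {j : ℕ} (hj : j ≤ a) :
    stairVertex b n X Y (n - (2 * j + 1)) = (X j, Y (j + 1)) := by
  rw [stairVertex, if_neg (by omega), show (n - (n - (2 * j + 1))) / 2 = j by omega,
      show (n - (n - (2 * j + 1)) + 1) / 2 = j + 1 by omega]

theorem vertex_last (h : IsUpperStair a b X Y) (hn : n = 2 * (a + b) + 4) :
    stairVertex b n X Y n = stairVertex b n X Y 0 := by
  have h1 := h.vertex_even_up hn (Nat.zero_le (a + 1))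
  have h2 := vertex_even_low (n := n) (X := X) (Y := Y) (Nat.zero_le (b + 1))
  simpa [h.X_zero, h.Y_zero] using h1.trans (by rw [h.X_zero, h.Y_zero]; exact h2.symm)

theorem edge_cases (h : IsUpperStair a b X Y) (hn : n = 2 * (a + b) + 4) {k : ℕ} (hk : k < n) :
    (∃ i ≤ b, k = 2 * i ∧ stairVertex b n X Y k = ((i : ℤ), (i : ℤ)) ∧
      stairVertex b n X Y (k + 1) = ((i : ℤ) + 1, (i : ℤ))) ∨
    (∃ i ≤ b, k = 2 * i + 1 ∧ stairVertex b n X Y k = ((i : ℤ) + 1, (i : ℤ)) ∧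
      stairVertex b n X Y (k + 1) = ((i : ℤ) + 1, (i : ℤ) + 1)) ∨
    (∃ j ≤ a, k = n - 2 * (j + 1) ∧ stairVertex b n X Y k = (X (j + 1), Y (j + 1)) ∧
      stairVertex b n X Y (k + 1) = (X j, Y (j + 1))) ∨
    ∃ j ≤ a, k = n - (2 * j + 1) ∧ stairVertex b n X Y k = (X j, Y (j + 1)) ∧
      stairVertex b n X Y (k + 1) = (X j, Y j) := by
  by_cases hkb : k ≤ 2 * b + 1
  · rcases Nat.even_or_odd' k with ⟨i, rfl | rfl⟩
    · exact Or.inl ⟨i, by omega, rfl, vertex_even_low (by omega), vertex_odd_low (by omega)⟩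
    · refine Or.inr (Or.inl ⟨i, by omega, rfl, vertex_odd_low (by omega), ?_⟩)
      rw [show 2 * i + 1 + 1 = 2 * (i + 1) by ring, vertex_even_low (by omega)]
      push_cast
      rfl
  · obtain ⟨m, rfl | rfl⟩ : ∃ j, k = n - 2 * (j + 1) ∨ k = n - (2 * j + 1) :=
      ⟨(n - k - 1) / 2, by omega⟩
    · refine Or.inr (Or.inr (Or.inl ⟨m, by omega, rfl, h.vertex_even_up hn (by omega), ?_⟩))
      rw [show n - 2 * (m + 1) + 1 = n - (2 * m + 1) by omega, vertex_odd_up hn (by omega)]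
    · refine Or.inr (Or.inr (Or.inr ⟨m, by omega, rfl, vertex_odd_up hn (by omega), ?_⟩))
      rw [show n - (2 * m + 1) + 1 = n - 2 * m by omega, h.vertex_even_up hn (by omega)]

theorem edge_even (h : IsUpperStair a b X Y) (hn : n = 2 * (a + b) + 4) {k : ℕ} (hk : k < n)
    (hk2 : k % 2 = 0) :
    (stairVertex b n X Y (k + 1)).1 ≠ (stairVertex b n X Y k).1 ∧
      (stairVertex b n X Y (k + 1)).2 = (stairVertex b n X Y k).2 := by
  rcases h.edge_cases hn hk with ⟨i, hi, h1, h2, h3⟩ | ⟨i, hi, h1, h2, h3⟩ | ⟨i, hi, h1, h2, h3⟩ |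
    ⟨i, hi, h1, h2, h3⟩
  · rw [h2, h3]; simp
  · omega
  · rw [h2, h3]; exact ⟨(h.X_lt i hi).ne, rfl⟩
  · omega

theorem edge_odd (h : IsUpperStair a b X Y) (hn : n = 2 * (a + b) + 4) {k : ℕ} (hk : k < n)
    (hk2 : k % 2 = 1) :
    (stairVertex b n X Y (k + 1)).1 = (stairVertex b n X Y k).1 ∧
      (stairVertex b n X Y (k + 1)).2 ≠ (stairVertex b n X Y k).2 := by
  rcases h.edge_cases hn hk with ⟨i, hi, h1, h2, h3⟩ | ⟨i, hi, h1, h2, h3⟩ | ⟨i, hi, h1, h2, h3⟩ |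
    ⟨i, hi, h1, h2, h3⟩
  · omega
  · rw [h2, h3]; simp
  · omega
  · rw [h2, h3]; exact ⟨rfl, (h.Y_lt i hi).ne⟩

theorem X_mono (h : IsUpperStair a b X Y) {i j : ℕ} (hij : i ≤ j) (hj : j ≤ a + 1) : X i ≤ X j := by
  induction j, hij using Nat.le_induction with
  | base => exact le_rfl
  | succ j _ ih => exact (ih (by omega)).trans (h.X_lt j (by omega)).le

theorem Y_mono (h : IsUpperStair a b X Y) {i j : ℕ} (hij : i ≤ j) (hj : j ≤ a + 1) : Y i ≤ Y j := by
  induction j, hij using Nat.le_induction with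
  | base => exact le_rfl
  | succ j _ ih => exact (ih (by omega)).trans (h.Y_lt j (by omega)).le

theorem low_onSeg (h : IsUpperStair a b X Y) (hn : n = 2 * (a + b) + 4) {k : ℕ}
    (hk : k ≤ 2 * b + 1) {p : ℤ × ℤ}
    (hp : onSeg (stairVertex b n X Y k) (stairVertex b n X Y (k + 1)) p) :
    p.2 ≤ p.1 ∧ (p.1 ≤ 0 → k = 0) ∧ ((b : ℤ) + 1 ≤ p.2 → k = 2 * b + 1) := by
  rcases h.edge_cases hn (show k < n by omega) with ⟨i, hi, h1, h2, h3⟩ | ⟨i, hi, h1, h2, h3⟩ |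
    ⟨i, hi, h1, h2, h3⟩ | ⟨i, hi, h1, h2, h3⟩
  · simp only [h2, h3, onSeg] at hp
    omega
  · simp only [h2, h3, onSeg] at hp
    omega
  · omega
  · omega

theorem up_onSeg (h : IsUpperStair a b X Y) (hn : n = 2 * (a + b) + 4) {k : ℕ}
    (hk : 2 * b + 2 ≤ k) (hkn : k < n) {p : ℤ × ℤ}
    (hp : onSeg (stairVertex b n X Y k) (stairVertex b n X Y (k + 1)) p) :
    p.1 < p.2 ∨ (p = (0, 0) ∧ k = n - 1) ∨ (p = ((b : ℤ) + 1, (b : ℤ) + 1) ∧ k = 2 * b + 2) := by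
  have := h.X_zero
  have := h.Y_zero
  have := h.X_last
  have := h.Y_last
  rcases h.edge_cases hn hkn with ⟨i, hi, h1, h2, h3⟩ | ⟨i, hi, h1, h2, h3⟩ |
    ⟨i, hi, h1, h2, h3⟩ | ⟨i, hi, h1, h2, h3⟩
  · omega
  · omega
  · simp only [h2, h3, onSeg] at hp
    have := h.X_lt i hi
    simp only [Prod.ext_iff]
    rcases hi.eq_or_lt with rfl | hlt
    · omega
    · have := h.above i hlt
      omega
  · simp only [h2, h3, onSeg] at hp
    have := h.Y_lt i hi
    simp only [Prod.ext_iff]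
    rcases i with _ | i
    · simp only [zero_add] at *
      omega
    · have := h.above i hi
      omega

theorem simple_of_lt (h : IsUpperStair a b X Y) (hn : n = 2 * (a + b) + 4) {k l : ℕ}
    (hkl : k < l) (hl : l < n) {p : ℤ × ℤ}
    (hp : onSeg (stairVertex b n X Y k) (stairVertex b n X Y (k + 1)) p)
    (hp' : onSeg (stairVertex b n X Y l) (stairVertex b n X Y (l + 1)) p) :
    (l = k + 1 ∧ p = stairVertex b n X Y l) ∨
      (k = 0 ∧ l = n - 1 ∧ p = stairVertex b n X Y 0) := by
  by_cases hkb : k ≤ 2 * b + 1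
  · by_cases hlb : 2 * b + 2 ≤ l
    · have h1 := h.low_onSeg hn hkb hp
      rcases h.up_onSeg hn hlb hl hp' with h2 | ⟨rfl, h3⟩ | ⟨rfl, h3⟩
      · omega
      · refine Or.inr ⟨h1.2.1 le_rfl, h3, ?_⟩
        exact (vertex_even_low (Nat.zero_le (b + 1))).symm
      · refine Or.inl ⟨by rw [h3, h1.2.2 le_rfl], ?_⟩
        rw [h3, show 2 * b + 2 = 2 * (b + 1) by ring, vertex_even_low le_rfl]
        push_cast
        rfl
    · left
      rcases h.edge_cases hn (hkl.trans hl) with ⟨i, hi, h1, h2, h3⟩ | ⟨i, hi, h1, h2, h3⟩ |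
        ⟨i, hi, h1, h2, h3⟩ | ⟨i, hi, h1, h2, h3⟩ <;>
      rcases h.edge_cases hn hl with ⟨j, hj, h1', h2', h3'⟩ | ⟨j, hj, h1', h2', h3'⟩ |
        ⟨j, hj, h1', h2', h3'⟩ | ⟨j, hj, h1', h2', h3'⟩ <;>
      simp only [h2, h2', h3, h3', onSeg, Prod.ext_iff] at * <;> omega
  · left
    rcases h.edge_cases hn (hkl.trans hl) with ⟨i, hi, h1, h2, h3⟩ | ⟨i, hi, h1, h2, h3⟩ |
      ⟨i, hi, h1, h2, h3⟩ | ⟨i, hi, h1, h2, h3⟩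
    · omega
    · omega
    all_goals
      have hXi := h.X_lt i hi
      have hYi := h.Y_lt i hi
      rcases h.edge_cases hn hl with ⟨j, hj, h1', h2', h3'⟩ | ⟨j, hj, h1', h2', h3'⟩ |
        ⟨j, hj, h1', h2', h3'⟩ | ⟨j, hj, h1', h2', h3'⟩
      · omega
      · omega
      all_goals
        have hXj := h.X_lt j hj
        have hYj := h.Y_lt j hj
        obtain rfl | rfl | hlt : i = j ∨ i = j + 1 ∨ j + 1 + 1 ≤ i := by omega
        · simp only [h2, h2', h3, h3', onSeg, Prod.ext_iff] at *
          omega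
        · simp only [h2, h2', h3, h3', onSeg, Prod.ext_iff] at *
          omega
        · have hXj1 := h.X_lt (j + 1) (by omega)
          have hYj1 := h.Y_lt (j + 1) (by omega)
          have hXm := h.X_mono hlt (by omega)
          have hYm := h.Y_mono hlt (by omega)
          simp only [h2, h2', h3, h3', onSeg, Prod.ext_iff] at *
          omega

end IsUpperStair

theorem ZMod.val_add_one_eq {n : ℕ} [NeZero n] (i : ZMod n) :
    (i.val + 1 < n ∧ (i + 1).val = i.val + 1) ∨ (i.val + 1 = n ∧ (i + 1).val = 0) := by
  have h : (i + 1).val = (i.val + 1) % n := by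
    conv_lhs => rw [← ZMod.natCast_zmod_val i, ← Nat.cast_succ, ZMod.val_natCast]
  have hlt := ZMod.val_lt i
  rcases Nat.lt_or_ge (i.val + 1) n with h1 | h1
  · exact Or.inl ⟨h1, by rw [h, Nat.mod_eq_of_lt h1]⟩
  · have h2 : i.val + 1 = n := by omega
    exact Or.inr ⟨h2, by rw [h, h2, Nat.mod_self]⟩

namespace IsUpperStair

variable {a b n : ℕ} {X Y : ℕ → ℤ} [NeZero n]

theorem vertex_val_add_one (h : IsUpperStair a b X Y) (hn : n = 2 * (a + b) + 4) (i : ZMod n) :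
    stairVertex b n X Y (i + 1).val = stairVertex b n X Y (i.val + 1) := by
  rcases i.val_add_one_eq with ⟨_, h2⟩ | ⟨h1, h2⟩
  · rw [h2]
  · rw [h2, h1, h.vertex_last hn]

theorem val_add_one_mod_two (hn : n = 2 * (a + b) + 4) (i : ZMod n) :
    (i + 1).val % 2 = (i.val + 1) % 2 := by
  rcases i.val_add_one_eq with ⟨_, h2⟩ | ⟨h1, h2⟩ <;> omega

theorem simple_aux (h : IsUpperStair a b X Y) (hn : n = 2 * (a + b) + 4) {i j : ZMod n}
    (hij : i.val < j.val) {p : ℤ × ℤ}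
    (hi : onSeg (stairVertex b n X Y i.val) (stairVertex b n X Y (i + 1).val) p)
    (hj : onSeg (stairVertex b n X Y j.val) (stairVertex b n X Y (j + 1).val) p) :
    (j = i + 1 ∧ p = stairVertex b n X Y j.val) ∨ (i = j + 1 ∧ p = stairVertex b n X Y i.val) := by
  rw [h.vertex_val_add_one hn] at hi hj
  rcases h.simple_of_lt hn hij j.val_lt hi hj with ⟨h1, h2⟩ | ⟨h1, h2, h3⟩
  · refine Or.inl ⟨ZMod.val_injective n ?_, h2⟩
    have := j.val_lt
    rcases i.val_add_one_eq with ⟨_, h4⟩ | ⟨h3, h4⟩ <;> omega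
  · refine Or.inr ⟨ZMod.val_injective n ?_, by rw [h1, h3]⟩
    rcases j.val_add_one_eq with ⟨_, h4⟩ | ⟨_, h4⟩ <;> omega

/-- The polygon between the unit stair and an upper stair. -/
def polygon (h : IsUpperStair a b X Y) (hn : n = 2 * (a + b) + 4) : RectPolygon n where
  v i := stairVertex b n X Y i.val
  nondeg i hi := by
    rw [h.vertex_val_add_one hn, Prod.ext_iff] at hi
    rcases Nat.mod_two_eq_zero_or_one i.val with h2 | h2
    · exact (h.edge_even hn i.val_lt h2).1 hi.1
    · exact (h.edge_odd hn i.val_lt h2).2 hi.2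
  axis i := by
    rw [h.vertex_val_add_one hn]
    rcases Nat.mod_two_eq_zero_or_one i.val with h2 | h2
    · exact Or.inr (h.edge_even hn i.val_lt h2).2
    · exact Or.inl (h.edge_odd hn i.val_lt h2).1
  alt i := by
    have hmod := val_add_one_mod_two hn i
    have h12 : i + 2 = i + 1 + 1 := by rw [add_assoc, one_add_one_eq_two]
    rw [h12, h.vertex_val_add_one hn (i + 1)]
    rcases Nat.mod_two_eq_zero_or_one i.val with h2 | h2
    · have h3 := (h.edge_even hn i.val_lt h2).1
      rw [← h.vertex_val_add_one hn] at h3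
      have h4 := (h.edge_odd hn (i + 1).val_lt (by omega)).2
      exact iff_of_false h3 h4
    · have h3 := (h.edge_odd hn i.val_lt h2).1
      rw [← h.vertex_val_add_one hn] at h3
      have h4 := (h.edge_even hn (i + 1).val_lt (by omega)).2
      exact iff_of_true h3 h4
  simple i j hij p hi hj := by
    rcases lt_trichotomy i.val j.val with hlt | heq | hlt
    · exact h.simple_aux hn hlt hi hj
    · exact absurd (ZMod.val_injective n heq).symm hij
    · exact (h.simple_aux hn hlt hj hi).symm

theorem polygon_v (h : IsUpperStair a b X Y) (hn : n = 2 * (a + b) + 4) {k : ℕ} (hk : k ≤ n) :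
    (h.polygon hn).v k = stairVertex b n X Y k := by
  change stairVertex b n X Y (k : ZMod n).val = _
  rcases hk.eq_or_lt with rfl | hlt
  · simp [h.vertex_last hn]
  · rw [ZMod.val_cast_of_lt hlt]

theorem sum_cross_polygon (h : IsUpperStair a b X Y) (hn : n = 2 * (a + b) + 4) :
    ∑ i : ZMod n, cross ((h.polygon hn).v i) ((h.polygon hn).v (i + 1)) =
      2 * (∑ j ∈ Finset.range (a + 1), (X (j + 1) - X j) * Y (j + 1)) - b * (b + 1) := by
  have h1 : ∑ i : ZMod n, cross ((h.polygon hn).v i) ((h.polygon hn).v (i + 1)) =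
      ∑ k ∈ Finset.range n, cross (stairVertex b n X Y k) (stairVertex b n X Y (k + 1)) := by
    rw [RectPolygon.sum_eq_sum_range]
    refine Finset.sum_congr rfl fun k hk => ?_
    have hk' := Finset.mem_range.1 hk
    rw [← Nat.cast_succ, h.polygon_v hn hk'.le, h.polygon_v hn hk']
  rw [h1, sum_cross_stairs hn (h.vertex_last hn)]
  · have h2 : ∀ j ∈ Finset.range (a + 1), ((stairVertex b n X Y (n - 2 * (j + 1))).1 -
        (stairVertex b n X Y (n - 2 * j)).1) * (stairVertex b n X Y (n - 2 * (j + 1))).2 =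
        (X (j + 1) - X j) * Y (j + 1) := by
      intro j hj
      have hj' := Finset.mem_range.1 hj
      rw [h.vertex_even_up hn hj', h.vertex_even_up hn hj'.le]
    have h3 : ∀ i ∈ Finset.range (b + 1), ((stairVertex b n X Y (2 * (i + 1))).1 -
        (stairVertex b n X Y (2 * i)).1) * (stairVertex b n X Y (2 * i)).2 = (i : ℤ) := by
      intro i hi
      have hi' := Finset.mem_range.1 hi
      rw [vertex_even_low hi', vertex_even_low hi'.le]
      push_cast
      ring
    have h4 : ∀ m : ℕ, 2 * ∑ i ∈ Finset.range (m + 1), (i : ℤ) = m * (m + 1) := by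
      intro m
      induction m with
      | zero => simp
      | succ m ih =>
        rw [Finset.sum_range_succ, mul_add, ih]
        push_cast
        ring
    rw [Finset.sum_congr rfl h2, Finset.sum_congr rfl h3, mul_sub, h4]
  · intro i hi
    rw [vertex_odd_low hi, vertex_even_low (by omega), vertex_even_low (by omega)]
    push_cast
    rfl
  · intro j hj
    rw [vertex_odd_up hn hj, h.vertex_even_up hn (by omega), h.vertex_even_up hn (by omega)]

theorem dvec_polygon (h : IsUpperStair a b X Y) (hn : n = 2 * (a + b) + 4) {k : ℕ} (hk : k < n) :
    (h.polygon hn).dvec k = stairVertex b n X Y (k + 1) - stairVertex b n X Y k := by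
  rw [RectPolygon.dvec, ← Nat.cast_succ, h.polygon_v hn hk, h.polygon_v hn hk.le]

theorem cross_dvec_polygon (h : IsUpperStair a b X Y) (hn : n = 2 * (a + b) + 4) {m : ℕ}
    (hm : m < n) :
    ((m % 2 = 1 ∨ m = 0 ∨ m = 2 * b + 2) →
        0 < cross ((h.polygon hn).dvec ((m : ZMod n) - 1)) ((h.polygon hn).dvec m)) ∧
      (m % 2 = 0 → m ≠ 0 → m ≠ 2 * b + 2 →
        cross ((h.polygon hn).dvec ((m : ZMod n) - 1)) ((h.polygon hn).dvec m) < 0) := by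
  obtain ⟨l, hl, hlm, hcast⟩ : ∃ l < n, (l + 1 = m ∨ (m = 0 ∧ l + 1 = n)) ∧
      (m : ZMod n) - 1 = (l : ZMod n) := by
    rcases m with _ | m
    · refine ⟨n - 1, by omega, Or.inr ⟨rfl, by omega⟩, ?_⟩
      rw [sub_eq_iff_eq_add, ← Nat.cast_succ, Nat.succ_eq_add_one, Nat.sub_add_cancel (by omega)]
      simp
    · exact ⟨m, by omega, Or.inl rfl, by simp⟩
  rw [hcast, h.dvec_polygon hn hl, h.dvec_polygon hn hm]
  rcases h.edge_cases hn hl with ⟨i, hi, h1, h2, h3⟩ | ⟨i, hi, h1, h2, h3⟩ |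
    ⟨i, hi, h1, h2, h3⟩ | ⟨i, hi, h1, h2, h3⟩ <;>
  rcases h.edge_cases hn hm with ⟨j, hj, h1', h2', h3'⟩ | ⟨j, hj, h1', h2', h3'⟩ |
    ⟨j, hj, h1', h2', h3'⟩ | ⟨j, hj, h1', h2', h3'⟩ <;>
  first
  | (exfalso; omega)
  | (have hprod := mul_pos (sub_pos.2 (h.Y_lt i hi)) (sub_pos.2 (h.X_lt j hj))
     refine ⟨fun _ => ?_, fun _ _ _ => ?_⟩ <;>
     first
     | (exfalso; omega)
     | (rw [h2, h3, h2', h3']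
        simp only [cross, Prod.fst_sub, Prod.snd_sub]
        linarith))
  | (have hprod := mul_pos (sub_pos.2 (h.X_lt i hi)) (sub_pos.2 (h.Y_lt j hj))
     refine ⟨fun _ => ?_, fun _ _ _ => ?_⟩ <;>
     first
     | (exfalso; omega)
     | (rw [h2, h3, h2', h3']
        simp only [cross, Prod.fst_sub, Prod.snd_sub]
        linarith))
  | (have hXj := h.X_lt j hj
     refine ⟨fun _ => ?_, fun _ _ _ => ?_⟩ <;>
     first
     | (exfalso; omega)
     | (rw [h2, h3, h2', h3']
        simp only [cross, Prod.fst_sub, Prod.snd_sub]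
        linarith))
  | (have hYi := h.Y_lt i hi
     refine ⟨fun _ => ?_, fun _ _ _ => ?_⟩ <;>
     first
     | (exfalso; omega)
     | (rw [h2, h3, h2', h3']
        simp only [cross, Prod.fst_sub, Prod.snd_sub]
        linarith))
  | (refine ⟨fun _ => ?_, fun _ _ _ => ?_⟩ <;>
     first
     | (exfalso; omega)
     | (rw [h2, h3, h2', h3']
        simp only [cross, Prod.fst_sub, Prod.snd_sub]
        linarith))

end IsUpperStair

/-- The heights at which a stair of total height `b` with `a + 1` steps, as equal as possible,
changes step. -/
def balancedHeight (a b j : ℕ) : ℕ := b / (a + 1) * j + min j (b % (a + 1))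

theorem balancedHeight_last (a b : ℕ) : balancedHeight a b (a + 1) = b := by
  rw [balancedHeight, min_eq_right (Nat.mod_lt b a.succ_pos).le, mul_comm, Nat.div_add_mod]

theorem balancedHeight_lt {a b : ℕ} (hab : a < b) (j : ℕ) :
    balancedHeight a b j < balancedHeight a b (j + 1) := by
  have h1 : 0 < b / (a + 1) := Nat.div_pos hab a.succ_pos
  rw [balancedHeight, balancedHeight, mul_add]
  omega

theorem isUpperStair_balancedHeight {a b : ℕ} (hab : a < b) :
    IsUpperStair a b (fun j => if j = a + 1 then (b : ℤ) + 1 else balancedHeight a b j)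
      (fun j => if j = 0 then 0 else (balancedHeight a b j : ℤ) + 1) where
  X_lt j hj := by
    have h1 := balancedHeight_lt hab j
    have h2 := balancedHeight_last a b
    rcases hj.eq_or_lt with rfl | hlt
    · rw [h2] at h1
      simp only [if_neg j.lt_succ_self.ne, if_true]
      omega
    · simp only [if_neg (show j ≠ a + 1 by omega), if_neg (show j + 1 ≠ a + 1 by omega)]
      exact_mod_cast h1
  Y_lt j _ := by
    have h1 := balancedHeight_lt hab j
    rcases j with _ | j
    · simp only [if_true, if_neg (Nat.succ_ne_zero _)]
      positivity
    · simp only [if_neg (Nat.succ_ne_zero _)]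
      exact_mod_cast Nat.add_lt_add_right h1 1
  X_zero := by simp [balancedHeight]
  Y_zero := if_pos rfl
  X_last := if_pos rfl
  Y_last := by simp [balancedHeight_last]
  above j hj := by simp [hj.ne]

theorem sum_balancedHeight (a b m : ℕ) :
    2 * ∑ j ∈ Finset.range m, ((balancedHeight a b (j + 1) : ℤ) - balancedHeight a b j) *
        (balancedHeight a b (j + 1) + 1) =
      (balancedHeight a b m : ℤ) ^ 2 + 2 * balancedHeight a b m + m * ((b / (a + 1) : ℕ) : ℤ) ^ 2 +
        (min m (b % (a + 1)) : ℕ) * (2 * ((b / (a + 1) : ℕ) : ℤ) + 1) := by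
  induction m with
  | zero => simp [balancedHeight]
  | succ m ih =>
    rw [Finset.sum_range_succ, mul_add, ih]
    rcases Nat.lt_or_ge m (b % (a + 1)) with h | h
    · simp only [balancedHeight, min_eq_left h.le, min_eq_left (Nat.succ_le_of_lt h)]
      push_cast
      ring
    · simp only [balancedHeight, min_eq_right h, min_eq_right (h.trans m.le_succ)]
      push_cast
      ring

theorem sum_upperStair_balancedHeight (a b : ℕ) :
    2 * ∑ j ∈ Finset.range (a + 1),
        ((if j + 1 = a + 1 then (b : ℤ) + 1 else balancedHeight a b (j + 1)) -
            (if j = a + 1 then (b : ℤ) + 1 else balancedHeight a b j)) *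
          (if j + 1 = 0 then 0 else (balancedHeight a b (j + 1) : ℤ) + 1) =
      (b : ℤ) ^ 2 + 4 * b + 2 + (a + 1) * ((b / (a + 1) : ℕ) : ℤ) ^ 2 +
        (b % (a + 1) : ℕ) * (2 * ((b / (a + 1) : ℕ) : ℤ) + 1) := by
  have h1 := sum_balancedHeight a b (a + 1)
  have h2 : ∀ j ∈ Finset.range a,
      ((if j + 1 = a + 1 then (b : ℤ) + 1 else balancedHeight a b (j + 1)) -
            (if j = a + 1 then (b : ℤ) + 1 else balancedHeight a b j)) *
          (if j + 1 = 0 then 0 else (balancedHeight a b (j + 1) : ℤ) + 1) =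
        ((balancedHeight a b (j + 1) : ℤ) - balancedHeight a b j) *
          (balancedHeight a b (j + 1) + 1) := by
    intro j hj
    have hj' := Finset.mem_range.1 hj
    rw [if_neg (by omega), if_neg (by omega), if_neg (by omega)]
  rw [Finset.sum_range_succ, balancedHeight_last,
    min_eq_right (Nat.mod_lt b a.succ_pos).le] at h1
  rw [Finset.sum_range_succ, Finset.sum_congr rfl h2, if_pos rfl, if_neg (by omega),
    if_neg (by omega), balancedHeight_last]
  push_cast at h1 ⊢
  linarith

theorem exists_realizes_twoStairSeq {a b n : ℕ} [NeZero n] (hn : n = 2 * (a + b) + 4)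
    (hab : a < b) : ∃ P : RectPolygon n, realizes (twoStairSeq a b) P ∧
      ∑ i : ZMod n, cross (P.v i) (P.v (i + 1)) =
        3 * b + 2 + (a + 1) * ((b / (a + 1) : ℕ) : ℤ) ^ 2 +
          (b % (a + 1) : ℕ) * (2 * ((b / (a + 1) : ℕ) : ℤ) + 1) := by
  have h := isUpperStair_balancedHeight hab
  have hsum : ∑ i : ZMod n, cross ((h.polygon hn).v i) ((h.polygon hn).v (i + 1)) =
      3 * b + 2 + (a + 1) * ((b / (a + 1) : ℕ) : ℤ) ^ 2 +
        (b % (a + 1) : ℕ) * (2 * ((b / (a + 1) : ℕ) : ℤ) + 1) := by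
    rw [h.sum_cross_polygon hn, sum_upperStair_balancedHeight]
    ring
  refine ⟨h.polygon hn, (realizes_twoStairSeq_iff hn _).2
    ⟨?_, fun m hm => h.cross_dvec_polygon hn hm⟩, hsum⟩
  rw [RectPolygon.ccw, hsum]
  positivity

/-- The arithmetic identity behind the two-stair minimum area, and the resulting
formula: for `b > a ≥ 1`, with `q = ⌊b/(a+1)⌋` and `r = b mod (a+1)`, the
minimum area of a lattice polygon realizing the two-opposite-stair xy-monotone
angle sequence with stair lengths `a` and `b` equals
`(a+1)(q+1)(q+2)/2 − a + r(q+2)`. -/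
theorem two_stair_min_area_formula (a b : ℕ) (ha : 1 ≤ a) (hab : a < b) :
    let q : ℕ := b / (a + 1)
    let r : ℕ := b % (a + 1)
    ((1 : ℚ) + 3 / 2 * b + 1 / 2 * (((a : ℚ) + 1 - r) * q ^ 2 + r * (q + 1) ^ 2)
        = ((a : ℚ) + 1) * (q + 1) * (q + 2) / 2 - a + r * (q + 2)) ∧
    IsLeast {A : ℤ | ∃ P : RectPolygon (2 * (a + b) + 4),
        realizes (twoStairSeq a b) P ∧ A = P.area}
      (((a : ℤ) + 1) * (q + 1) * (q + 2) / 2 - a + r * (q + 2)) := by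
  intro q r
  have hb : (a + 1) * q + r = b := Nat.div_add_mod b (a + 1)
  have hbZ : ((a : ℤ) + 1) * q + r = b := by exact_mod_cast hb
  obtain ⟨t, ht⟩ : ∃ t : ℤ, ((q : ℤ) + 1) * (q + 2) = 2 * t := by
    have := Int.even_mul_succ_self ((q : ℤ) + 1)
    obtain ⟨t, ht⟩ := this
    exact ⟨t, by linarith⟩
  have hdiv : ((a : ℤ) + 1) * (q + 1) * (q + 2) / 2 = (a + 1) * t := by
    rw [mul_assoc, ht, mul_left_comm, Int.mul_ediv_cancel_left _ two_ne_zero]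
  rw [hdiv]
  refine ⟨?_, ?_, ?_⟩
  · have hbQ : ((a : ℚ) + 1) * q + r = b := by exact_mod_cast hb
    rw [← hbQ]
    ring
  · obtain ⟨P, hP, hsum⟩ := exists_realizes_twoStairSeq (n := 2 * (a + b) + 4) rfl hab
    refine ⟨P, hP, ?_⟩
    have hval : ∑ i : ZMod (2 * (a + b) + 4), cross (P.v i) (P.v (i + 1)) =
        2 * (((a : ℤ) + 1) * t - a + r * (q + 2)) := by
      rw [hsum]
      linear_combination (a + 1 : ℤ) * ht - 3 * hbZ
    rw [RectPolygon.area, hval, Int.mul_ediv_cancel_left _ two_ne_zero]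
  · rintro A ⟨P, hP, rfl⟩
    have hle := RectPolygon.two_stair_area_ge rfl (q : ℤ) hP
    have hval : 2 * (2 * (b : ℤ) + 1) + 2 * q * b - ((a : ℤ) + 1) * (q * (q + 1)) =
        2 * (((a : ℤ) + 1) * t - a + r * (q + 2)) := by
      linear_combination (a + 1 : ℤ) * ht - (4 + 2 * (q : ℤ)) * hbZ
    linarith
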